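/- arXiv:2104.02616 — 6 statements merged into one kernel-verified Lean document; each statement's English description precedes it below -/
import Mathlib

section
/- Let H be a complex Hilbert space and P an orthogonal projection on H. (i) For every selfadjoint bounded operator X on H, the operator i·(XP − PX) (scalar multiplication by the complex unit i) is selfadjoint and codiagonal with respect to P. (ii) Conversely, every selfadjoint bounded operator Y with PY + YP = Y is of this form: taking X := −i·(YP − PY), the operator X is selfadjoint and Y = i·(XP − PX). Hence {Y selfadjoint : PY + YP = Y} = {i·(XP − PX) : X selfadjoint}. -/
section Codiagonal

variable {A : Type*} [Ring A]

lemma IsSelfAdjoint.I_smul_commutator [StarRing A] [Module ℂ A] [StarModule ℂ A] {x p : A}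
    (hx : IsSelfAdjoint x) (hp : IsSelfAdjoint p) :
    IsSelfAdjoint (Complex.I • (x * p - p * x)) := by
  rw [isSelfAdjoint_iff, star_smul, star_sub, star_mul, star_mul, hx.star_eq, hp.star_eq,
    Complex.star_def, Complex.conj_I, neg_smul, ← smul_neg, neg_sub]

lemma IsIdempotentElem.mul_commutator_add_commutator_mul {p : A} (hp : IsIdempotentElem p)
    (x : A) : p * (x * p - p * x) + (x * p - p * x) * p = x * p - p * x := by
  rw [mul_sub, sub_mul, ← mul_assoc p p x, mul_assoc x p p, hp.eq, mul_assoc p x p]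
  abel

lemma IsIdempotentElem.mul_mul_self_eq_zero_of_codiagonal {p y : A} (hp : IsIdempotentElem p)
    (hy : p * y + y * p = y) : p * y * p = 0 := by
  have h := congrArg (p * ·) hy
  simpa only [mul_add, ← mul_assoc, hp.eq, add_eq_left] using h

lemma IsIdempotentElem.commutator_commutator_of_codiagonal {p y : A} (hp : IsIdempotentElem p)
    (hy : p * y + y * p = y) : (y * p - p * y) * p - p * (y * p - p * y) = y := by
  rw [sub_mul, mul_sub, mul_assoc y p p, ← mul_assoc p p y, ← mul_assoc p y p, hp.eq,
    hp.mul_mul_self_eq_zero_of_codiagonal hy, sub_zero, zero_sub, sub_neg_eq_add, add_comm, hy]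

end Codiagonal


/-- Let `H` be a complex Hilbert space and `P` an orthogonal projection on `H`.
(i) For every selfadjoint bounded `X`, the operator `i•(XP − PX)` is selfadjoint and codiagonal
with respect to `P`.  (ii) Conversely, every selfadjoint `Y` with `PY + YP = Y` is of this
form: with `X := −i•(YP − PY)`, the operator `X` is selfadjoint and `Y = i•(XP − PX)`.
Hence `{Y selfadjoint : PY + YP = Y} = {i•(XP − PX) : X selfadjoint}`. -/
theorem codiagonal_eq_commutators
    {H : Type*} [NormedAddCommGroup H] [InnerProductSpace ℂ H] [CompleteSpace H]
    (P : H →L[ℂ] H)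
    (hP_sa : ContinuousLinearMap.adjoint P = P) (hP_idem : P * P = P) :
    (∀ X : H →L[ℂ] H, ContinuousLinearMap.adjoint X = X →
      ContinuousLinearMap.adjoint (Complex.I • (X * P - P * X)) = Complex.I • (X * P - P * X) ∧
      P * (Complex.I • (X * P - P * X)) + (Complex.I • (X * P - P * X)) * P
        = Complex.I • (X * P - P * X)) ∧
    (∀ Y : H →L[ℂ] H, ContinuousLinearMap.adjoint Y = Y → P * Y + Y * P = Y →
      (ContinuousLinearMap.adjoint (-(Complex.I • (Y * P - P * Y)))
          = -(Complex.I • (Y * P - P * Y)) ∧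
        Y = Complex.I • ((-(Complex.I • (Y * P - P * Y))) * P
              - P * (-(Complex.I • (Y * P - P * Y)))))) ∧
    {Y : H →L[ℂ] H | ContinuousLinearMap.adjoint Y = Y ∧ P * Y + Y * P = Y}
      = {Z : H →L[ℂ] H | ∃ X : H →L[ℂ] H,
          ContinuousLinearMap.adjoint X = X ∧ Z = Complex.I • (X * P - P * X)} := by
  have hp : IsIdempotentElem P := hP_idem
  have direct (X : H →L[ℂ] H) (hX : ContinuousLinearMap.adjoint X = X) :
      ContinuousLinearMap.adjoint (Complex.I • (X * P - P * X)) = Complex.I • (X * P - P * X) ∧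
      P * (Complex.I • (X * P - P * X)) + (Complex.I • (X * P - P * X)) * P
        = Complex.I • (X * P - P * X) := by
    refine ⟨IsSelfAdjoint.I_smul_commutator (x := X) (p := P) hX hP_sa, ?_⟩
    rw [mul_smul_comm, smul_mul_assoc, ← smul_add, hp.mul_commutator_add_commutator_mul]
  have converse (Y : H →L[ℂ] H) (hY : ContinuousLinearMap.adjoint Y = Y)
      (hYP : P * Y + Y * P = Y) :
      ContinuousLinearMap.adjoint (-(Complex.I • (Y * P - P * Y)))
          = -(Complex.I • (Y * P - P * Y)) ∧
        Y = Complex.I • ((-(Complex.I • (Y * P - P * Y))) * P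
              - P * (-(Complex.I • (Y * P - P * Y)))) := by
    refine ⟨(IsSelfAdjoint.I_smul_commutator (x := Y) (p := P) hY hP_sa).neg, ?_⟩
    rw [← neg_smul, smul_mul_assoc, mul_smul_comm, ← smul_sub,
      hp.commutator_commutator_of_codiagonal hYP, smul_smul, mul_neg, Complex.I_mul_I, neg_neg,
      one_smul]
  refine ⟨direct, converse, Set.ext fun Y => ⟨?_, ?_⟩⟩
  · rintro ⟨hY, hYP⟩
    exact ⟨_, converse Y hY hYP⟩
  · rintro ⟨X, hX, rfl⟩
    exact direct X hX
end

section
/- Let H be a complex Hilbert space, E := EuclideanSpace ℂ (Fin r) for r : ℕ, and let φ : E →L[ℂ] H satisfy φ*φ = 1 (a point of the Stiefel manifold). For any bounded operator X : E →L[ℂ] H, define He := (φ*X + (φ*X)*)/2 and Sk := (φ*X − (φ*X)*)/2 (the hermitian and skew-hermitian parts of φ*X : E →L[ℂ] E), and set T := φ∘Sk + (1 − φφ*)∘X and N := φ∘He. Then: (i) X = T + N; (ii) T*φ + φ*T = 0 (T is tangent to the Stiefel manifold at φ); (iii) He is selfadjoint, so N has the form φ∘S with S selfadjoint (N is normal to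 the Stiefel manifold at φ); and (iv) the real part of the trace over E of T*∘N is zero. -/
open ContinuousLinearMap in
/-- The trace of the adjoint of an operator is the complex conjugate of its trace. -/
theorem trace_adjoint_eq_star_trace {E : Type*} [NormedAddCommGroup E] [InnerProductSpace ℂ E]
    [FiniteDimensional ℂ E] [CompleteSpace E] (A : E →L[ℂ] E) :
    LinearMap.trace ℂ E (adjoint A : E →L[ℂ] E).toLinearMap =
      star (LinearMap.trace ℂ E A.toLinearMap) := by
  rw [LinearMap.trace_eq_sum_inner _ (stdOrthonormalBasis ℂ E),
    LinearMap.trace_eq_sum_inner _ (stdOrthonormalBasis ℂ E), star_sum]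
  refine Finset.sum_congr rfl fun i _ => ?_
  simp [adjoint_inner_right]

open ContinuousLinearMap in
/-- The product of a skew-adjoint and a selfadjoint operator has purely imaginary trace. -/
theorem re_trace_skewAdjoint_comp_selfAdjoint {E : Type*} [NormedAddCommGroup E]
    [InnerProductSpace ℂ E] [FiniteDimensional ℂ E] [CompleteSpace E] (K S : E →L[ℂ] E)
    (hK : adjoint K = -K) (hS : adjoint S = S) :
    (LinearMap.trace ℂ E (K ∘L S : E →L[ℂ] E).toLinearMap).re = 0 := by
  have h := trace_adjoint_eq_star_trace (K ∘L S)
  rw [adjoint_comp, hK, hS, comp_neg, toLinearMap_neg, map_neg, toLinearMap_comp, toLinearMap_comp,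
    LinearMap.trace_comp_comm'] at h
  have := congrArg Complex.re h
  simp only [Complex.neg_re, Complex.star_def, Complex.conj_re] at this
  rw [toLinearMap_comp]
  linarith

open ContinuousLinearMap in
/-- Let `H` be a complex Hilbert space, `E := EuclideanSpace ℂ (Fin r)`,
and `φ : E →L[ℂ] H` with `φ*φ = 1` (a point of the Stiefel manifold).  For a bounded
operator `X : E →L[ℂ] H`, set `He := (φ*X + (φ*X)*)/2`, `Sk := (φ*X − (φ*X)*)/2`,
`T := φ∘Sk + (1 − φφ*)∘X` and `N := φ∘He`.  Then: (i) `X = T + N`;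
(ii) `T*φ + φ*T = 0` (`T` is tangent at `φ`); (iii) `He` is selfadjoint (so `N = φ∘S` with
`S` selfadjoint, i.e. `N` is normal at `φ`); (iv) `Re (tr (T*∘N)) = 0`. -/
theorem stiefel_tangent_normal_decomposition
    {H : Type*} [NormedAddCommGroup H] [InnerProductSpace ℂ H] [CompleteSpace H]
    {r : ℕ} (φ X : EuclideanSpace ℂ (Fin r) →L[ℂ] H)
    (hφ : adjoint φ ∘L φ = 1)
    (He Sk : EuclideanSpace ℂ (Fin r) →L[ℂ] EuclideanSpace ℂ (Fin r))
    (hHe : He = (2 : ℂ)⁻¹ • (adjoint φ ∘L X + adjoint (adjoint φ ∘L X)))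
    (hSk : Sk = (2 : ℂ)⁻¹ • (adjoint φ ∘L X - adjoint (adjoint φ ∘L X)))
    (T N : EuclideanSpace ℂ (Fin r) →L[ℂ] H)
    (hT : T = φ ∘L Sk + (1 - φ ∘L adjoint φ) ∘L X)
    (hN : N = φ ∘L He) :
    X = T + N ∧
    adjoint T ∘L φ + adjoint φ ∘L T = 0 ∧
    adjoint He = He ∧
    (LinearMap.trace ℂ (EuclideanSpace ℂ (Fin r))
      ((adjoint T ∘L N : EuclideanSpace ℂ (Fin r) →L[ℂ] EuclideanSpace ℂ (Fin r)) :
        EuclideanSpace ℂ (Fin r) →ₗ[ℂ] EuclideanSpace ℂ (Fin r))).re = 0 := by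
  have h2 : (starRingEnd ℂ) (2 : ℂ)⁻¹ = 2⁻¹ := by rw [map_inv₀, map_ofNat]
  have hSk_adj : adjoint Sk = -Sk := by
    rw [hSk, map_smulₛₗ, map_sub, adjoint_adjoint, h2]
    module
  have hHe_adj : adjoint He = He := by
    rw [hHe, map_smulₛₗ, map_add, adjoint_adjoint, h2, add_comm]
  have hsum : Sk + He = adjoint φ ∘L X := by
    rw [hSk, hHe]
    module
  have hφT : adjoint φ ∘L T = Sk := by
    ext1 v
    have hφv (w) : adjoint φ (φ w) = w := congrArg (fun A => A w) hφ
    simp [hT, hφv]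
  have hTφ : adjoint T ∘L φ = -Sk := by
    rw [← hSk_adj, ← hφT, adjoint_comp, adjoint_adjoint]
  refine ⟨?_, ?_, hHe_adj, ?_⟩
  · ext1 v
    have hv : Sk v + He v = adjoint φ (X v) := congrArg (fun A => A v) hsum
    simp [hT, hN, ← hv]
    abel
  · rw [hTφ, hφT, neg_add_cancel]
  · rw [hN, ← comp_assoc, hTφ]
    exact re_trace_skewAdjoint_comp_selfAdjoint _ _ (by rw [map_neg, hSk_adj]) hHe_adj
end

section
/- Let H be a complex Hilbert space and E := EuclideanSpace ℂ (Fin r). Let γ : ℝ → (E →L[ℂ] H) be twice differentiable with γ(t)*γ(t) = 1 for every t, and suppose that for each t ∈ ℝ there exists a selfadjoint operator S(t) : E →L[ℂ] E with γ''(t) = −γ(t)∘S(t). Then γ satisfies the geodesic equation γ''(t) + γ(t)∘(γ'(t)*∘γ'(t)) = 0 for every t ∈ ℝ (equivalently, S(t) = γ'(t)*∘γ'(t)). -/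
/-- Evaluation of a differentiable curve of complex-linear operators at a fixed vector. -/
theorem HasDerivAt.clm_eval {E H : Type*} [NormedAddCommGroup E] [NormedSpace ℂ E]
    [NormedAddCommGroup H] [NormedSpace ℂ H] {γ : ℝ → (E →L[ℂ] H)} {v : E →L[ℂ] H} {t : ℝ}
    (h : HasDerivAt γ v t) (x : E) : HasDerivAt (fun s => γ s x) (v x) t :=
  (((ContinuousLinearMap.apply ℂ H x).restrictScalars ℝ).hasFDerivAt (x := γ t)).comp_hasDerivAt t h

open ContinuousLinearMap in
/-- Let `H` be a complex Hilbert space and `E := EuclideanSpace ℂ (Fin r)`.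
Let `γ : ℝ → (E →L[ℂ] H)` be twice differentiable with `γ(t)*γ(t) = 1` for every `t`, and
suppose that for each `t` there is a selfadjoint `S(t) : E →L[ℂ] E` with
`γ''(t) = −γ(t)∘S(t)`.  Then `γ''(t) + γ(t)∘(γ'(t)*∘γ'(t)) = 0` for every `t`
(equivalently `S(t) = γ'(t)*∘γ'(t)`). -/
theorem stiefel_normal_second_derivative_geodesic
    {H : Type*} [NormedAddCommGroup H] [InnerProductSpace ℂ H] [CompleteSpace H]
    {r : ℕ} (γ γ' γ'' : ℝ → (EuclideanSpace ℂ (Fin r) →L[ℂ] H))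
    (hγ' : ∀ t : ℝ, HasDerivAt γ (γ' t) t)
    (hγ'' : ∀ t : ℝ, HasDerivAt γ' (γ'' t) t)
    (hSt : ∀ t : ℝ, adjoint (γ t) ∘L γ t = 1)
    (hnormal : ∀ t : ℝ, ∃ S : EuclideanSpace ℂ (Fin r) →L[ℂ] EuclideanSpace ℂ (Fin r),
      adjoint S = S ∧ γ'' t = -(γ t ∘L S)) :
    ∀ t : ℝ, γ'' t + γ t ∘L (adjoint (γ' t) ∘L γ' t) = 0 := by
  intro t
  obtain ⟨S, hS, hSγ⟩ := hnormal t
  have hinner : ∀ (s : ℝ) (x y), inner ℂ (γ s x) (γ s y) = inner ℂ x y := fun s x y => by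
    rw [← adjoint_inner_right, ← comp_apply, hSt]
    rfl
  have hfirst : ∀ (s : ℝ) (x y),
      inner ℂ (γ s x) (γ' s y) + inner ℂ (γ' s x) (γ s y) = 0 := fun s x y => by
    have h := ((hγ' s).clm_eval x).inner ℂ ((hγ' s).clm_eval y)
    simp only [hinner] at h
    exact h.unique (hasDerivAt_const s _)
  have hsecond : ∀ x y, inner ℂ (γ t x) (γ'' t y) + inner ℂ (γ' t x) (γ' t y)
      + (inner ℂ (γ' t x) (γ' t y) + inner ℂ (γ'' t x) (γ t y)) = 0 := fun x y => by
    have h := (((hγ' t).clm_eval x).inner ℂ ((hγ'' t).clm_eval y)).add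
      (((hγ'' t).clm_eval x).inner ℂ ((hγ' t).clm_eval y))
    refine h.unique ((hasDerivAt_const t (0 : ℂ)).congr_of_eventuallyEq ?_)
    exact Filter.Eventually.of_forall fun s => hfirst s x y
  have hSeq : S = adjoint (γ' t) ∘L γ' t := by
    refine ContinuousLinearMap.ext fun y => ext_inner_left ℂ fun x => ?_
    have h := hsecond x y
    have hsymm : inner ℂ (S x) y = inner ℂ x (S y) := by
      rw [← adjoint_inner_right, hS]
    simp only [hSγ, neg_apply, comp_apply, inner_neg_left, inner_neg_right, hinner, hsymm] at h
    rw [comp_apply, adjoint_inner_right]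
    linear_combination (-1 / 2 : ℂ) * h
  rw [hSγ, ← hSeq, neg_add_cancel]
end

section
/- Let H be a complex Hilbert space and (ξₙ)ₙ∈ℕ a sequence in H with ∑ₙ ‖ξₙ‖² = 1. Then: (i) there exists a bounded operator ρ : H →L[ℂ] H with ρx = ∑'ₙ ⟪ξₙ, x⟫ • ξₙ for every x ∈ H; (ii) ρ is selfadjoint and positive; (iii) for every bounded operator A : H →L[ℂ] H the family (⟪ξₙ, A ξₙ⟫)ₙ is summable, and for every Hilbert basis (bᵢ)ᵢ of H the family (⟪bᵢ, ρ(A bᵢ)⟫)ᵢ is summable with ∑'ᵢ ⟪bᵢ, ρ(A bᵢ)⟫ = ∑'ₙ ⟪ξₙ, A ξₙ⟫. In other words, the density matrix of the normal state φ = ∑ₙ ω_{ξₙ} is ρ = ∑ₙ ‖ξₙ‖² Pₙ, where Pₙ is the orthogonal projection onto the line spanned by ξₙ. -/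
open scoped InnerProductSpace

/-- Parseval's identity for a Hilbert basis. -/
theorem HilbertBasis.hasSum_sq_norm_inner {𝕜 E ι : Type*} [RCLike 𝕜] [NormedAddCommGroup E]
    [InnerProductSpace 𝕜 E] (b : HilbertBasis ι 𝕜 E) (x : E) :
    HasSum (fun i => ‖⟪b i, x⟫_𝕜‖ ^ 2) (‖x‖ ^ 2) := by
  have h := b.hasSum_inner_mul_inner x x
  simp_rw [inner_self_eq_norm_sq_to_K,
    ← inner_conj_symm x, RCLike.conj_mul] at h
  exact_mod_cast h

/-- A square-summable family of vectors has square-summable coordinates. -/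
theorem HilbertBasis.summable_prod_sq_norm_inner {𝕜 E ι κ : Type*} [RCLike 𝕜]
    [NormedAddCommGroup E] [InnerProductSpace 𝕜 E] (b : HilbertBasis ι 𝕜 E) {η : κ → E}
    (hη : Summable fun n => ‖η n‖ ^ 2) :
    Summable fun p : κ × ι => ‖⟪b p.2, η p.1⟫_𝕜‖ ^ 2 := by
  rw [summable_prod_of_nonneg fun _ => by positivity]
  refine ⟨fun n => (b.hasSum_sq_norm_inner (η n)).summable, ?_⟩
  simpa only [(b.hasSum_sq_norm_inner _).tsum_eq] using hη

/-- The coordinate products of two square-summable families of vectors are summable. -/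
theorem HilbertBasis.summable_prod_inner_mul_inner {𝕜 E ι κ : Type*} [RCLike 𝕜]
    [NormedAddCommGroup E] [InnerProductSpace 𝕜 E] (b : HilbertBasis ι 𝕜 E) {η ξ : κ → E}
    (hη : Summable fun n => ‖η n‖ ^ 2) (hξ : Summable fun n => ‖ξ n‖ ^ 2) :
    Summable fun p : κ × ι => ⟪η p.1, b p.2⟫_𝕜 * ⟪b p.2, ξ p.1⟫_𝕜 := by
  refine Summable.of_norm_bounded
    ((b.summable_prod_sq_norm_inner hη).add (b.summable_prod_sq_norm_inner hξ)) fun p => ?_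
  rw [norm_mul, norm_inner_symm]
  nlinarith [sq_nonneg (‖⟪b p.2, η p.1⟫_𝕜‖ - ‖⟪b p.2, ξ p.1⟫_𝕜‖),
    sq_nonneg ‖⟪b p.2, η p.1⟫_𝕜‖, sq_nonneg ‖⟪b p.2, ξ p.1⟫_𝕜‖]

/-- Let `H` be a complex Hilbert space and `(ξₙ)` a sequence in `H` with
`∑ₙ ‖ξₙ‖² = 1`.  Then: (i) there is a bounded operator `ρ` with
`ρ x = ∑'ₙ ⟪ξₙ, x⟫ • ξₙ`; (ii) `ρ` is selfadjoint and positive; (iii) for every bounded `A`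
the family `(⟪ξₙ, Aξₙ⟫)ₙ` is summable, and for every Hilbert basis `(bᵢ)` the family
`(⟪bᵢ, ρ(Abᵢ)⟫)ᵢ` is summable with `∑'ᵢ ⟪bᵢ, ρ(Abᵢ)⟫ = ∑'ₙ ⟪ξₙ, Aξₙ⟫`.  (The density matrix
of `φ = ∑ₙ ω_{ξₙ}` is `ρ = ∑ₙ ‖ξₙ‖² Pₙ`.) -/
theorem density_matrix_of_normal_state
    {H : Type*} [NormedAddCommGroup H] [InnerProductSpace ℂ H] [CompleteSpace H]
    (ξ : ℕ → H) (hξ : HasSum (fun n => ‖ξ n‖ ^ 2) 1) :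
    ∃ ρ : H →L[ℂ] H,
      (∀ x : H, ρ x = ∑' n : ℕ, ⟪ξ n, x⟫_ℂ • ξ n) ∧
      IsSelfAdjoint ρ ∧ ρ.IsPositive ∧
      ∀ A : H →L[ℂ] H,
        Summable (fun n : ℕ => ⟪ξ n, A (ξ n)⟫_ℂ) ∧
        ∀ (ι : Type*) (b : HilbertBasis ι ℂ H),
          Summable (fun i : ι => ⟪b i, ρ (A (b i))⟫_ℂ) ∧
          ∑' i : ι, ⟪b i, ρ (A (b i))⟫_ℂ = ∑' n : ℕ, ⟪ξ n, A (ξ n)⟫_ℂ := by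
  have hs := hξ.summable
  have hR : Summable fun n => InnerProductSpace.rankOne ℂ (ξ n) (ξ n) := by
    refine Summable.of_norm ?_
    simpa only [InnerProductSpace.norm_rankOne, ← sq] using hs
  have hρ (x : H) : HasSum (fun n => ⟪ξ n, x⟫_ℂ • ξ n)
      ((∑' n, InnerProductSpace.rankOne ℂ (ξ n) (ξ n)) x) := by
    simpa using hR.hasSum.mapL (ContinuousLinearMap.apply ℂ H x)
  have hpos : (∑' n, InnerProductSpace.rankOne ℂ (ξ n) (ξ n)).IsPositive := by
    rw [← ContinuousLinearMap.nonneg_iff_isPositive]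
    exact tsum_nonneg fun n =>
      (ContinuousLinearMap.nonneg_iff_isPositive _).2 (InnerProductSpace.isPositive_rankOne_self _)
  refine ⟨_, fun x => (hρ x).tsum_eq.symm, hpos.isSelfAdjoint, hpos, fun A => ?_⟩
  constructor
  · refine Summable.of_norm_bounded (hs.mul_left ‖A‖) fun n => ?_
    calc ‖⟪ξ n, A (ξ n)⟫_ℂ‖ ≤ ‖ξ n‖ * ‖A (ξ n)‖ := norm_inner_le_norm _ _
      _ ≤ ‖ξ n‖ * (‖A‖ * ‖ξ n‖) := by gcongr; exact A.le_opNorm _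
      _ = ‖A‖ * ‖ξ n‖ ^ 2 := by ring
  intro ι b
  have hη : Summable fun n => ‖A.adjoint (ξ n)‖ ^ 2 := by
    refine Summable.of_nonneg_of_le (fun _ => by positivity) (fun n => ?_)
      (hs.mul_left (‖A.adjoint‖ ^ 2))
    rw [← mul_pow]
    gcongr
    exact A.adjoint.le_opNorm _
  have hF := b.summable_prod_inner_mul_inner hη hs
  have hrow (n : ℕ) : HasSum (fun i => ⟪A.adjoint (ξ n), b i⟫_ℂ * ⟪b i, ξ n⟫_ℂ)
      ⟪ξ n, A (ξ n)⟫_ℂ := by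
    rw [← A.adjoint_inner_left]
    exact b.hasSum_inner_mul_inner _ _
  have hcol (i : ι) : HasSum (fun n => ⟪A.adjoint (ξ n), b i⟫_ℂ * ⟪b i, ξ n⟫_ℂ)
      ⟪b i, (∑' n, InnerProductSpace.rankOne ℂ (ξ n) (ξ n)) (A (b i))⟫_ℂ := by
    simpa [A.adjoint_inner_left, inner_smul_right] using
      (hρ (A (b i))).mapL (innerSL ℂ (b i))
  have hsum := hF.prod_symm.hasSum.prod_fiberwise hcol
  refine ⟨hsum.summable, hsum.tsum_eq.trans ?_⟩
  exact ((Equiv.prodComm ι ℕ).tsum_eq fun p : ℕ × ι =>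
    ⟪A.adjoint (ξ p.1), b p.2⟫_ℂ * ⟪b p.2, ξ p.1⟫_ℂ).trans
      (hF.hasSum.prod_fiberwise hrow).tsum_eq.symm
end

section
/- Let A be a C*-algebra over ℂ (not necessarily unital), J a directed preorder, and u : J → A an increasing net such that for every j: 0 ≤ u_j and ‖u_j‖ ≤ 1, and for every a ∈ A, ‖a − u_j * a‖ → 0 and ‖a − a * u_j‖ → 0 along J (an approximate unit). Then for every continuous positive linear functional φ : A →L[ℂ] ℂ, the net φ(u_j) converges to ‖φ‖ along J. -/
open scoped ComplexOrder in
/-- **Cauchy–Schwarz** for positive linear functionals on a C⋆-algebra. -/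
theorem PositiveLinearMap.norm_apply_star_mul_sq_le
    {A : Type*} [NonUnitalCStarAlgebra A] [PartialOrder A] [StarOrderedRing A]
    (f : A →ₚ[ℂ] ℂ) (a b : A) :
    ‖f (star a * b)‖ ^ 2 ≤ (f (star a * a)).re * (f (star b * b)).re := by
  have h := norm_inner_le_norm (𝕜 := ℂ) (f.toPreGNS a) (f.toPreGNS b)
  rw [f.preGNS_inner_def, f.preGNS_norm_def, f.preGNS_norm_def] at h
  simp only [f.ofPreGNS_toPreGNS] at h
  have ha : 0 ≤ (f (star a * a)).re := (Complex.le_def.mp (f.map_nonneg (star_mul_self_nonneg a))).1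
  have hb : 0 ≤ (f (star b * b)).re := (Complex.le_def.mp (f.map_nonneg (star_mul_self_nonneg b))).1
  calc ‖f (star a * b)‖ ^ 2
      ≤ (√(f (star a * a)).re * √(f (star b * b)).re) ^ 2 := by gcongr
    _ = _ := by rw [mul_pow, Real.sq_sqrt ha, Real.sq_sqrt hb]

/-- A nonnegative contraction in a C⋆-algebra dominates its square. -/
theorem CStarAlgebra.mul_self_le_self_of_norm_le_one
    {A : Type*} [NonUnitalCStarAlgebra A] [PartialOrder A] [StarOrderedRing A]
    {a : A} (ha : 0 ≤ a) (ha' : ‖a‖ ≤ 1) : a * a ≤ a := by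
  have hs : IsSelfAdjoint (CFC.sqrt a) := .of_nonneg (CFC.sqrt_nonneg a)
  have hss : CFC.sqrt a * CFC.sqrt a = a := CFC.sqrt_mul_sqrt_self a ha
  have hc : CFC.sqrt a * a * CFC.sqrt a = a * a := by
    nth_rewrite 2 [← hss]
    rw [← mul_assoc, hss, mul_assoc, hss]
  have h := CStarAlgebra.star_left_conjugate_le_norm_smul (a := CFC.sqrt a)
    (IsSelfAdjoint.of_nonneg ha)
  rw [hs.star_eq, hss, hc] at h
  refine h.trans ?_
  rw [← sub_nonneg]
  have : a - ‖a‖ • a = (1 - ‖a‖) • a := by rw [sub_smul, one_smul]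
  rw [this]
  exact smul_nonneg (sub_nonneg.mpr ha') ha


open Filter in
/-- Let `A` be a (possibly non-unital) C*-algebra over `ℂ` with its
canonical order, `J` a directed preorder, and `(u_j)` an increasing net with `0 ≤ u_j`,
`‖u_j‖ ≤ 1`, and `‖a − u_j a‖ → 0`, `‖a − a u_j‖ → 0` for all `a` (an approximate unit).
Then for every continuous positive linear functional `φ : A →L[ℂ] ℂ`, the net `φ(u_j)`
converges to `‖φ‖`. -/
theorem positive_functional_tendsto_norm_of_approximate_unit
    {A : Type*} [NonUnitalCStarAlgebra A] [PartialOrder A] [StarOrderedRing A]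
    {J : Type*} [Preorder J] [IsDirected J (· ≤ ·)] [Nonempty J]
    (u : J → A) (hu_mono : Monotone u)
    (hu_nonneg : ∀ j : J, 0 ≤ u j) (hu_norm : ∀ j : J, ‖u j‖ ≤ 1)
    (hu_left : ∀ a : A, Tendsto (fun j : J => ‖a - u j * a‖) atTop (nhds 0))
    (hu_right : ∀ a : A, Tendsto (fun j : J => ‖a - a * u j‖) atTop (nhds 0))
    (φ : A →L[ℂ] ℂ)
    (hφpos : ∀ a : A, ∃ r : ℝ, 0 ≤ r ∧ φ (star a * a) = (r : ℂ)) :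
    Tendsto (fun j : J => φ (u j)) atTop (nhds ((‖φ‖ : ℝ) : ℂ)) := by
  open scoped ComplexOrder in
  let f : A →ₚ[ℂ] ℂ := PositiveLinearMap.mk₀ φ.toLinearMap fun x hx => by
    obtain ⟨a, rfl⟩ := CStarAlgebra.nonneg_iff_eq_star_mul_self.mp hx
    obtain ⟨r, hr, h⟩ := hφpos a
    change 0 ≤ φ (star a * a)
    rw [h]
    exact_mod_cast hr
  have hf (x : A) : f x = φ x := rfl
  have hmono {x y : A} (hxy : x ≤ y) : (φ x).re ≤ (φ y).re :=
    (Complex.le_def.mp (OrderHomClass.mono f hxy)).1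
  have hreal (j : J) : φ (u j) = ((φ (u j)).re : ℂ) := by
    obtain ⟨a, ha⟩ := CStarAlgebra.nonneg_iff_eq_star_mul_self.mp (hu_nonneg j)
    obtain ⟨r, -, h⟩ := hφpos a
    rw [ha, h, Complex.ofReal_re]
  have hbound (j : J) : (φ (u j)).re ≤ ‖φ‖ :=
    (Complex.re_le_norm _).trans (φ.unit_le_opNorm _ (hu_norm j))
  have hbdd : BddAbove (Set.range fun j => (φ (u j)).re) :=
    ⟨‖φ‖, by rintro _ ⟨j, rfl⟩; exact hbound j⟩
  have hlim := tendsto_atTop_ciSup (f := fun j => (φ (u j)).re)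
    (fun i j hij => hmono (hu_mono hij)) hbdd
  set L : ℝ := ⨆ j, (φ (u j)).re
  have hLle : L ≤ ‖φ‖ := ciSup_le hbound
  have hL0 : 0 ≤ L := by
    obtain ⟨j⟩ := ‹Nonempty J›
    have h0 := hmono (hu_nonneg j)
    rw [map_zero, Complex.zero_re] at h0
    exact h0.trans (le_ciSup hbdd j)
  have hsq (a : A) : ‖φ a‖ ^ 2 ≤ L * ‖φ‖ * ‖a‖ ^ 2 := by
    have hua : Tendsto (fun j => u j * a) atTop (nhds a) := by
      rw [tendsto_iff_norm_sub_tendsto_zero]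
      simpa only [norm_sub_rev] using hu_left a
    have hφua : Tendsto (fun j => ‖φ (u j * a)‖ ^ 2) atTop (nhds (‖φ a‖ ^ 2)) :=
      (((φ.continuous.tendsto a).comp hua).norm).pow 2
    refine le_of_tendsto' hφua fun j => ?_
    have hcs := f.norm_apply_star_mul_sq_le (u j) a
    rw [(IsSelfAdjoint.of_nonneg (hu_nonneg j)).star_eq] at hcs
    simp only [hf] at hcs
    have huu : (φ (u j * u j)).re ≤ L :=
      (hmono (CStarAlgebra.mul_self_le_self_of_norm_le_one (hu_nonneg j) (hu_norm j))).trans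
        (le_ciSup hbdd j)
    have haa : (φ (star a * a)).re ≤ ‖φ‖ * ‖a‖ ^ 2 := by
      refine ((Complex.re_le_norm _).trans (φ.le_opNorm _)).trans_eq ?_
      rw [CStarRing.norm_star_mul_self, sq]
    have haa0 : 0 ≤ (φ (star a * a)).re := by
      obtain ⟨r, hr, h⟩ := hφpos a
      rwa [h, Complex.ofReal_re]
    calc ‖φ (u j * a)‖ ^ 2 ≤ (φ (u j * u j)).re * (φ (star a * a)).re := hcs
      _ ≤ L * (‖φ‖ * ‖a‖ ^ 2) := mul_le_mul huu haa haa0 hL0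
      _ = L * ‖φ‖ * ‖a‖ ^ 2 := by ring
  have hop : ‖φ‖ ≤ √(L * ‖φ‖) := φ.opNorm_le_bound (Real.sqrt_nonneg _) fun a => by
    refine (sq_le_sq₀ (by positivity) (by positivity)).mp ?_
    rw [mul_pow, Real.sq_sqrt (by positivity)]
    exact hsq a
  have hLeq : L = ‖φ‖ := by
    refine hLle.antisymm ?_
    rw [Real.le_sqrt (norm_nonneg _) (by positivity), sq] at hop
    rcases (norm_nonneg φ).eq_or_lt with h | h
    · rwa [← h]
    · exact le_of_mul_le_mul_right hop h
  rw [← hLeq]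
  exact ((Complex.continuous_ofReal.tendsto L).comp hlim).congr fun j => (hreal j).symm
end

section
/- Let H be a complex inner product space and let U, V : H → H be conjugate-linear isometries (additive norm-preserving maps with U(c•x) = conj(c)•(U x) and V(c•x) = conj(c)•(V x) for all c ∈ ℂ, x ∈ H). Assume that for every x ∈ H there exists c ∈ ℂ with U x = c • V x (equivalently, U and V induce the same map on the rank-one projections |x⟩⟨x| ↦ |Ux⟩⟨Ux|). Then there exists a single λ ∈ ℂ with ‖λ‖ = 1 such that U x = λ • V x for every x ∈ H; i.e. U and V agree up to a global phase. -/
/-- If `f` and `g` are semilinear maps over a field, `g` is injective, and `f` is pointwise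
proportional to `g`, then the proportionality factor at one nonzero vector works everywhere. -/
theorem map_eq_smul_of_forall_exists_map_eq_smul {K L E F : Type*} [Field K] [Field L]
    {σ : K →+* L} [RingHomSurjective σ] [AddCommGroup E] [Module K E] [AddCommGroup F] [Module L F]
    (f g : E →ₛₗ[σ] F) (hg : Function.Injective g) (h : ∀ x, ∃ c : L, f x = c • g x)
    {x : E} (hx : x ≠ 0) {a : L} (ha : f x = a • g x) (y : E) : f y = a • g y := by
  obtain ⟨b, hb⟩ := h y
  obtain ⟨c, hc⟩ := h (x + y)
  have hrel : (a - c) • g x = (c - b) • g y := by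
    rw [map_add, map_add, ha, hb, smul_add] at hc
    rw [sub_smul, sub_smul, sub_eq_sub_iff_add_eq_add, hc, add_comm]
  by_cases hac : a = c
  · rw [← hac, sub_self, zero_smul, sub_smul] at hrel
    rw [hb, sub_eq_zero.mp hrel.symm]
  · obtain ⟨t, ht⟩ := RingHomSurjective.is_surjective (σ := σ) ((a - c)⁻¹ * (c - b))
    have hxy : x = t • y := hg <| by
      rw [map_smulₛₗ, ht, mul_smul, ← hrel, inv_smul_smul₀ (sub_ne_zero.mpr hac)]
    have ht0 : σ t ≠ 0 := (map_ne_zero σ).mpr fun h0 => hx (by rw [hxy, h0, zero_smul])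
    rw [hxy, map_smulₛₗ, map_smulₛₗ, smul_comm] at ha
    exact smul_right_injective F ht0 ha

/-- Let `H` be a complex inner product space and `U, V : H → H`
conjugate-linear isometries.  If for every `x` there is `c ∈ ℂ` with `U x = c • V x`
(i.e. `U` and `V` induce the same map on rank-one projections), then there is a single
phase `λ ∈ ℂ`, `‖λ‖ = 1`, with `U x = λ • V x` for every `x`. -/
theorem antilinear_isometries_agree_up_to_phase
    {H : Type*} [NormedAddCommGroup H] [InnerProductSpace ℂ H]
    (U V : H →ₛₗᵢ[starRingEnd ℂ] H)
    (h : ∀ x : H, ∃ c : ℂ, U x = c • V x) :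
    ∃ lam : ℂ, ‖lam‖ = 1 ∧ ∀ x : H, U x = lam • V x := by
  rcases subsingleton_or_nontrivial H with _ | _
  · exact ⟨1, norm_one, fun x => by simp [Subsingleton.elim x 0]⟩
  obtain ⟨x, hx⟩ := exists_ne (0 : H)
  obtain ⟨a, ha⟩ := h x
  have hnorm : ‖a‖ * ‖x‖ = ‖x‖ := by
    rw [← V.norm_map x, ← norm_smul, ← ha, U.norm_map, V.norm_map]
  exact ⟨a, (mul_eq_right₀ (norm_ne_zero_iff.mpr hx)).mp hnorm, fun y =>
    map_eq_smul_of_forall_exists_map_eq_smul U.toLinearMap V.toLinearMap V.injective h hx ha y⟩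
end
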